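/- Let T, N, B₁, B₂ : ℝ → ℝ⁴ be a Frenet frame of a pseudo null curve in E₁⁴ satisfying the Frenet equations T' = N, N' = τB₁, B₁' = σN − τB₂, B₂' = −T − σB₁, with σ, τ smooth and τ nowhere zero. Then there is no nonzero constant vector U such that g(T(s), U) is constant; i.e., there exist no 0-type pseudo null slant helices. -/

import Mathlib

noncomputable def g (v w : Fin 4 → ℝ) : ℝ :=
  -(v 0 * w 0) + v 1 * w 1 + v 2 * w 2 + v 3 * w 3

theorem hasDerivAt_g_const {X : ℝ → Fin 4 → ℝ} {X' : Fin 4 → ℝ} {s : ℝ}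
    (hX : HasDerivAt X X' s) (U : Fin 4 → ℝ) :
    HasDerivAt (fun t => g (X t) U) (g X' U) s := by
  have h := hasDerivAt_pi.mp hX
  exact ((((h 0).mul_const (U 0)).neg.add ((h 1).mul_const (U 1))).add
    ((h 2).mul_const (U 2))).add ((h 3).mul_const (U 3))

theorem g_deriv_eq_zero_of_const {X : ℝ → Fin 4 → ℝ} {X' : Fin 4 → ℝ} {s a : ℝ}
    {U : Fin 4 → ℝ} (hX : HasDerivAt X X' s) (h : ∀ t, g (X t) U = a) : g X' U = 0 := by
  have hd := hasDerivAt_g_const hX U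
  simp only [h] at hd
  exact hd.unique (hasDerivAt_const s a)

theorem g_comm (v w : Fin 4 → ℝ) : g v w = g w v := by
  unfold g; ring

theorem g_smul_left (c : ℝ) (v w : Fin 4 → ℝ) : g (c • v) w = c * g v w := by
  simp only [g, Pi.smul_apply, smul_eq_mul]; ring

theorem g_sub_left (u v w : Fin 4 → ℝ) : g (u - v) w = g u w - g v w := by
  simp only [g, Pi.sub_apply]; ring

theorem g_neg_left (v w : Fin 4 → ℝ) : g (-v) w = -g v w := by
  simp only [g, Pi.neg_apply]; ring

open scoped Matrix in
theorem mulVec_vec4_eq_g (A B C D U : Fin 4 → ℝ) :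
    Matrix.of ![A, B, C, D] *ᵥ ![-U 0, U 1, U 2, U 3] = ![g A U, g B U, g C U, g D U] := by
  ext i
  fin_cases i <;> simp [Matrix.mulVec, dotProduct, Fin.sum_univ_four, g]

open scoped Matrix in
/-- A vector orthogonal to all members of a pseudo null frame vanishes. -/
theorem eq_zero_of_g_pseudoNull_frame_eq_zero {t n b₁ b₂ U : Fin 4 → ℝ}
    (htt : g t t = 1) (hb₁b₁ : g b₁ b₁ = 1) (hnn : g n n = 0) (hb₂b₂ : g b₂ b₂ = 0)
    (hnb₂ : g n b₂ = 1) (htn : g t n = 0) (htb₁ : g t b₁ = 0) (htb₂ : g t b₂ = 0)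
    (hnb₁ : g n b₁ = 0) (hb₁b₂ : g b₁ b₂ = 0)
    (ht : g t U = 0) (hn : g n U = 0) (hb₁ : g b₁ U = 0) (hb₂ : g b₂ U = 0) : U = 0 := by
  let F : Matrix (Fin 4) (Fin 4) ℝ := Matrix.of ![t, n, b₁, b₂]
  let M : Matrix (Fin 4) (Fin 4) ℝ := (Matrix.of ![![-t 0, t 1, t 2, t 3],
    ![-b₂ 0, b₂ 1, b₂ 2, b₂ 3], ![-b₁ 0, b₁ 1, b₁ 2, b₁ 3], ![-n 0, n 1, n 2, n 3]])ᵀ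
  have hFM : F * M = 1 := by
    have col (j : Fin 4) (V : Fin 4 → ℝ) (hM : M.col j = ![-V 0, V 1, V 2, V 3]) (i : Fin 4) :
        (F * M) i j = ![g t V, g n V, g b₁ V, g b₂ V] i := by
      rw [← mulVec_vec4_eq_g, ← hM]; rfl
    ext i j
    fin_cases j
    · refine (col 0 t rfl i).trans ?_
      fin_cases i <;> simp [htt, g_comm n t, g_comm b₁ t, g_comm b₂ t, htn, htb₁, htb₂]
    · refine (col 1 b₂ rfl i).trans ?_
      fin_cases i <;> simp [htb₂, hnb₂, hb₁b₂, hb₂b₂]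
    · refine (col 2 b₁ rfl i).trans ?_
      fin_cases i <;> simp [htb₁, hnb₁, hb₁b₁, g_comm b₂ b₁, hb₁b₂]
    · refine (col 3 n rfl i).trans ?_
      fin_cases i <;> simp [htn, hnn, g_comm b₁ n, g_comm b₂ n, hnb₁, hnb₂]
  have hFU : F *ᵥ ![-U 0, U 1, U 2, U 3] = 0 := by
    rw [mulVec_vec4_eq_g, ht, hn, hb₁, hb₂]
    ext i; fin_cases i <;> rfl
  have hU : ![-U 0, U 1, U 2, U 3] = 0 := by
    rw [← Matrix.one_mulVec ![-U 0, U 1, U 2, U 3], ← mul_eq_one_comm.mp hFM,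
      ← Matrix.mulVec_mulVec, hFU, Matrix.mulVec_zero]
  ext i
  fin_cases i
  · simpa using congrFun hU 0
  · exact congrFun hU 1
  · exact congrFun hU 2
  · exact congrFun hU 3

theorem stmt9
    (T N B₁ B₂ : ℝ → Fin 4 → ℝ) (σ τ : ℝ → ℝ)
    (hσ : ContDiff ℝ (⊤ : ℕ∞) σ) (hτ : ContDiff ℝ (⊤ : ℕ∞) τ)
    (hτ0 : ∀ s, τ s ≠ 0)
    (hT : ∀ s, HasDerivAt T (N s) s)
    (hN : ∀ s, HasDerivAt N (τ s • B₁ s) s)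
    (hB₁ : ∀ s, HasDerivAt B₁ (σ s • N s - τ s • B₂ s) s)
    (hB₂ : ∀ s, HasDerivAt B₂ (-T s - σ s • B₁ s) s)
    (hTT : ∀ s, g (T s) (T s) = 1) (hB₁B₁ : ∀ s, g (B₁ s) (B₁ s) = 1)
    (hNN : ∀ s, g (N s) (N s) = 0) (hB₂B₂ : ∀ s, g (B₂ s) (B₂ s) = 0)
    (hNB₂ : ∀ s, g (N s) (B₂ s) = 1)
    (hTN : ∀ s, g (T s) (N s) = 0) (hTB₁ : ∀ s, g (T s) (B₁ s) = 0)
    (hTB₂ : ∀ s, g (T s) (B₂ s) = 0) (hNB₁ : ∀ s, g (N s) (B₁ s) = 0)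
    (hB₁B₂ : ∀ s, g (B₁ s) (B₂ s) = 0)
    :
    ¬ ∃ U : Fin 4 → ℝ, U ≠ 0 ∧ ∃ a : ℝ, ∀ s, g (T s) U = a := by
  rintro ⟨U, hU, a, ha⟩
  have hNU s : g (N s) U = 0 := g_deriv_eq_zero_of_const (hT s) ha
  have hB₁U s : g (B₁ s) U = 0 := by
    have h := g_deriv_eq_zero_of_const (hN s) hNU
    rw [g_smul_left] at h
    exact (mul_eq_zero.mp h).resolve_left (hτ0 s)
  have hB₂U s : g (B₂ s) U = 0 := by
    have h := g_deriv_eq_zero_of_const (hB₁ s) hB₁U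
    rw [g_sub_left, g_smul_left, g_smul_left, hNU, mul_zero, zero_sub, neg_eq_zero] at h
    exact (mul_eq_zero.mp h).resolve_left (hτ0 s)
  have hTU s : g (T s) U = 0 := by
    have h := g_deriv_eq_zero_of_const (hB₂ s) hB₂U
    rwa [g_sub_left, g_neg_left, g_smul_left, hB₁U, mul_zero, sub_zero, neg_eq_zero] at h
  exact hU (eq_zero_of_g_pseudoNull_frame_eq_zero (hTT 0) (hB₁B₁ 0) (hNN 0) (hB₂B₂ 0) (hNB₂ 0)
    (hTN 0) (hTB₁ 0) (hTB₂ 0) (hNB₁ 0) (hB₁B₂ 0) (hTU 0) (hNU 0) (hB₁U 0) (hB₂U 0))
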